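/- There exists a universal constant δ > 0 such that for every quasi-median graph X, the contact graph CX is δ-hyperbolic, i.e. every geodesic triangle in CX is δ-slim. -/

import Mathlib

namespace QM

variable {V : Type*}

/-- `y₁` and `y₂` lie (in this order) on a common geodesic from `x₁` to `x₂`. -/
def OnGeod (X : SimpleGraph V) (x₁ y₁ y₂ x₂ : V) : Prop :=
  X.dist x₁ y₁ + X.dist y₁ y₂ + X.dist y₂ x₂ = X.dist x₁ x₂

/-- `(y₁, y₂, y₃)` is a `k`-quasi-median triple for `(x₁, x₂, x₃)` (without minimality). -/
def IsQMTriple (X : SimpleGraph V) (x₁ x₂ x₃ y₁ y₂ y₃ : V) (k : ℕ) : Prop :=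
  OnGeod X x₁ y₁ y₂ x₂ ∧ OnGeod X x₁ y₁ y₃ x₃ ∧ OnGeod X x₂ y₂ y₃ x₃ ∧
    X.dist y₁ y₂ = k ∧ X.dist y₁ y₃ = k ∧ X.dist y₂ y₃ = k

/-- `y` is a quasi-median of the triple `(x₁, x₂, x₃)`: it is a `k`-quasi-median triple
with `k` as small as possible. -/
def IsQuasiMedianTriple (X : SimpleGraph V) (x₁ x₂ x₃ : V) (y : V × V × V) : Prop :=
  ∃ k : ℕ, IsQMTriple X x₁ x₂ x₃ y.1 y.2.1 y.2.2 k ∧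
    ∀ (k' : ℕ) (z₁ z₂ z₃ : V), IsQMTriple X x₁ x₂ x₃ z₁ z₂ z₃ k' → k ≤ k'

/-- The complete multipartite graph `K_{1,1,2}`: the complete graph on four vertices
with the edge between vertices `2` and `3` removed. -/
def K112 : SimpleGraph (Fin 4) :=
  SimpleGraph.fromRel (fun i j => ¬(i = 2 ∧ j = 3) ∧ ¬(i = 3 ∧ j = 2))

/-- The 1-skeleton of the 3-cube. -/
def cubeGraph : SimpleGraph (Fin 3 → Bool) :=
  SimpleGraph.fromRel (fun x y => ∃! i, x i ≠ y i)

/-- The 6-cycle. -/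
def C6 : SimpleGraph (Fin 6) := SimpleGraph.fromRel (fun i j => j = i + 1)

/-- A set of vertices is convex if it contains every vertex lying on a geodesic between
two of its members. -/
def IsConvexSet (X : SimpleGraph V) (S : Set V) : Prop :=
  ∀ x ∈ S, ∀ y ∈ S, ∀ z : V, X.dist x z + X.dist z y = X.dist x y → z ∈ S

/-- The convex hull of a set of vertices. -/
def convexHullSet (X : SimpleGraph V) (S : Set V) : Set V :=
  ⋂₀ {T : Set V | S ⊆ T ∧ IsConvexSet X T}

/-- A quasi-median graph: a connected graph in which every triple of vertices has a unique
quasi-median, with no induced `K_{1,1,2}`, and in which the convex hull of every isometrically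
embedded 6-cycle is isomorphic to the 3-cube. -/
structure IsQuasiMedian (X : SimpleGraph V) : Prop where
  connected : X.Connected
  uniqueQuasiMedian : ∀ x₁ x₂ x₃ : V, ∃! y : V × V × V, IsQuasiMedianTriple X x₁ x₂ x₃ y
  noK112 : IsEmpty (SimpleGraph.Embedding K112 X)
  hullOfC6IsCube : ∀ f : Fin 6 → V,
    (∀ i j, C6.Adj i j → X.Adj (f i) (f j)) →
    (∀ i j, X.dist (f i) (f j) = C6.dist i j) →
    Nonempty (SimpleGraph.Iso
      (SimpleGraph.induce (convexHullSet X (Set.range f)) X) cubeGraph)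

/-- Two edges are two sides of a common triangle, or opposite sides of a common square. -/
def SideRel (X : SimpleGraph V) (e f : Sym2 V) : Prop :=
  (∃ a b c : V, X.Adj a b ∧ X.Adj a c ∧ X.Adj b c ∧ e = s(a, b) ∧ f = s(a, c)) ∨
  (∃ a b c d : V, X.Adj a b ∧ X.Adj c d ∧ X.Adj a c ∧ X.Adj b d ∧ a ≠ d ∧ b ≠ c ∧
    e = s(a, b) ∧ f = s(c, d))

/-- The equivalence class of an edge under the equivalence relation generated by `SideRel`. -/
def hypClass (X : SimpleGraph V) (e : Sym2 V) : Set (Sym2 V) :=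
  {f | Relation.EqvGen (SideRel X) e f}

/-- A hyperplane: the equivalence class of some edge of `X`. -/
def IsHyperplane (X : SimpleGraph V) (H : Set (Sym2 V)) : Prop :=
  ∃ e ∈ X.edgeSet, H = hypClass X e

/-- The type of hyperplanes of `X`. -/
def Hyperplane (X : SimpleGraph V) := {H : Set (Sym2 V) // IsHyperplane X H}

/-- Edges `e`, `e'` sharing the endpoint `p`, not lying in a common clique, that are
adjacent sides of a square of `X`: their dual hyperplanes intersect at `p`. -/
def IntersectAt (X : SimpleGraph V) (e e' : Sym2 V) (p : V) : Prop :=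
  ∃ a b : V, e = s(p, a) ∧ e' = s(p, b) ∧ X.Adj p a ∧ X.Adj p b ∧ a ≠ b ∧ ¬ X.Adj a b ∧
    ∃ q : V, q ≠ p ∧ X.Adj a q ∧ X.Adj b q

/-- Edges `e`, `e'` sharing the endpoint `p`, not lying in a common clique, and not adjacent
sides of any square of `X`: their dual hyperplanes osculate at `p`. -/
def OsculateAt (X : SimpleGraph V) (e e' : Sym2 V) (p : V) : Prop :=
  ∃ a b : V, e = s(p, a) ∧ e' = s(p, b) ∧ X.Adj p a ∧ X.Adj p b ∧ a ≠ b ∧ ¬ X.Adj a b ∧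
    ¬ ∃ q : V, q ≠ p ∧ X.Adj a q ∧ X.Adj b q

/-- Hyperplanes `H` and `H'` intersect at `p`. -/
def HypIntersectAt (X : SimpleGraph V) (H H' : Hyperplane X) (p : V) : Prop :=
  ∃ e ∈ H.1, ∃ e' ∈ H'.1, IntersectAt X e e' p

/-- Hyperplanes `H` and `H'` osculate at `p`. -/
def HypOsculateAt (X : SimpleGraph V) (H H' : Hyperplane X) (p : V) : Prop :=
  ∃ e ∈ H.1, ∃ e' ∈ H'.1, OsculateAt X e e' p

/-- Hyperplanes `H` and `H'` intersect. -/
def HypIntersect (X : SimpleGraph V) (H H' : Hyperplane X) : Prop :=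
  ∃ p : V, HypIntersectAt X H H' p

/-- Hyperplanes `H` and `H'` osculate. -/
def HypOsculate (X : SimpleGraph V) (H H' : Hyperplane X) : Prop :=
  ∃ p : V, HypOsculateAt X H H' p

/-- The contact graph `𝒞X`: hyperplanes are adjacent iff they intersect or osculate. -/
def contactGraph (X : SimpleGraph V) : SimpleGraph (Hyperplane X) :=
  SimpleGraph.fromRel (fun H H' => HypIntersect X H H' ∨ HypOsculate X H H')

/-- The crossing graph `ΔX`: hyperplanes are adjacent iff they intersect. -/
def crossingGraph (X : SimpleGraph V) : SimpleGraph (Hyperplane X) :=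
  SimpleGraph.fromRel (fun H H' => HypIntersect X H H')

/-- The (vertex set of the) carrier of a hyperplane: all endpoints of its edges. -/
def hypCarrier (X : SimpleGraph V) (H : Hyperplane X) : Set V :=
  {v : V | ∃ e ∈ H.1, v ∈ e}

/-- A set of edges `H` (e.g. a hyperplane) separates `p` from `q` if every walk from `p`
to `q` uses an edge of `H`. -/
def Separates (X : SimpleGraph V) (H : Set (Sym2 V)) (p q : V) : Prop :=
  ∀ w : X.Walk p q, ∃ e ∈ w.edges, e ∈ H

/-- `f` is a `(λ, c)`-quasi-isometry from `(A, dA)` to `(B, dB)`. -/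
def IsQuasiIsometry {A B : Type*} (lam c : ℝ) (dA : A → A → ℝ) (dB : B → B → ℝ)
    (f : A → B) : Prop :=
  (∀ x y : A, dA x y / lam - c ≤ dB (f x) (f y) ∧ dB (f x) (f y) ≤ lam * dA x y + c) ∧
    ∀ b : B, ∃ a : A, dB (f a) b ≤ c

end QM

namespace QM

/-- A walk is a geodesic if its length equals the distance between its endpoints. -/
def IsGeodesicWalk {V : Type*} (X : SimpleGraph V) {u v : V} (p : X.Walk u v) : Prop :=
  p.length = X.dist u v

section Graph

variable {V : Type*} {X : SimpleGraph V}

lemma exists_adj_dist_eq (hX : X.Connected) {u v : V} {n : ℕ} (h : X.dist u v = n + 1) :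
    ∃ c, X.Adj u c ∧ X.dist c v = n := by
  obtain ⟨p, hp⟩ := hX.exists_walk_length_eq_dist u v
  cases p with
  | nil => simp at h
  | @cons _ c _ huc p =>
    refine ⟨c, huc, ?_⟩
    have h1 := SimpleGraph.dist_le p
    have h2 := hX.dist_triangle (u := u) (v := c) (w := v)
    rw [SimpleGraph.dist_eq_one_iff_adj.2 huc] at h2
    rw [SimpleGraph.Walk.length_cons] at hp
    omega

lemma dist_le_succ_of_adj (hX : X.Connected) {u c v : V} (h : X.Adj u c) :
    X.dist u v ≤ X.dist c v + 1 := by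
  have h2 := hX.dist_triangle (u := u) (v := c) (w := v)
  rw [SimpleGraph.dist_eq_one_iff_adj.2 h] at h2
  omega

lemma dist_add_dist_of_mem_support (hX : X.Connected) {x z a : V} {p : X.Walk x z}
    (hp : IsGeodesicWalk X p) (ha : a ∈ p.support) :
    X.dist x a + X.dist a z = X.dist x z := by
  classical
  have h1 := SimpleGraph.dist_le (p.takeUntil a ha)
  have h2 := SimpleGraph.dist_le (p.dropUntil a ha)
  have h3 := congrArg SimpleGraph.Walk.length (p.take_spec ha)
  have h4 := hX.dist_triangle (u := x) (v := a) (w := z)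
  rw [SimpleGraph.Walk.length_append] at h3
  unfold IsGeodesicWalk at hp
  omega

lemma isGeodesicWalk_of_cons (hX : X.Connected) {x v z : V} {h : X.Adj x v} {p : X.Walk v z}
    (hp : IsGeodesicWalk X (.cons h p)) : IsGeodesicWalk X p := by
  have h1 := SimpleGraph.dist_le p
  have h2 := dist_le_succ_of_adj hX h (v := z)
  unfold IsGeodesicWalk at *
  rw [SimpleGraph.Walk.length_cons] at hp
  omega

/-- Two vertices of a geodesic are at distance the difference of their distances to its start. -/
lemma dist_le_of_mem_support (hX : X.Connected) {x z a b : V} {p : X.Walk x z}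
    (hp : IsGeodesicWalk X p) (ha : a ∈ p.support) (hb : b ∈ p.support) :
    X.dist a b ≤ (X.dist x a - X.dist x b) + (X.dist x b - X.dist x a) := by
  induction p with
  | nil =>
    simp only [SimpleGraph.Walk.support_nil, List.mem_singleton] at ha hb
    simp [ha, hb]
  | @cons x v z h p ih =>
    have hp' := isGeodesicWalk_of_cons hX hp
    have key : ∀ c ∈ p.support, X.dist x c = X.dist v c + 1 := by
      intro c hc
      have h1 := dist_add_dist_of_mem_support hX hp' hc
      have h2 := dist_add_dist_of_mem_support hX hp (a := c) (by simp [hc])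
      unfold IsGeodesicWalk at *
      rw [SimpleGraph.Walk.length_cons] at hp
      omega
    rw [SimpleGraph.Walk.support_cons, List.mem_cons] at ha hb
    rcases ha with rfl | ha
    · simp
    rcases hb with rfl | hb
    · simp [SimpleGraph.dist_comm]
    have := ih hp' ha hb
    rw [key a ha, key b hb]
    omega

/-- A walk meets every sphere around its start whose radius is at most the distance between its
endpoints. -/
lemma exists_mem_support_dist_eq (hX : X.Connected) {x z : V} (p : X.Walk x z) {i : ℕ}
    (hi : i ≤ X.dist x z) : ∃ a ∈ p.support, X.dist x a = i := by
  suffices H : ∀ {u : V} (q : X.Walk u z), X.dist x u ≤ i → ∃ a ∈ q.support, X.dist x a = i from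
    H p (by simp)
  intro u q hu
  induction q with
  | nil => exact ⟨_, by simp, le_antisymm hu hi⟩
  | @cons u v z h q ih =>
    rcases hu.eq_or_lt with hu | hu
    · exact ⟨u, by simp, hu⟩
    have h1 := hX.dist_triangle (u := x) (v := u) (w := v)
    rw [SimpleGraph.dist_eq_one_iff_adj.2 h] at h1
    obtain ⟨a, ha, hai⟩ := ih p hi (by omega)
    exact ⟨a, by simp [ha], hai⟩

/-- Characterization of the graph distance as the unique function that is `1`-Lipschitz along
edges and can always be decreased along an edge. -/
lemma dist_eq_of_descent (D : V → V → ℕ) (h0 : ∀ i, D i i = 0)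
    (heq : ∀ i j, D i j = 0 → i = j) (hlip : ∀ i j k, X.Adj i j → D i k ≤ D j k + 1)
    (hdesc : ∀ i k, D i k ≠ 0 → ∃ j, X.Adj i j ∧ D j k + 1 = D i k) (i j : V) :
    X.dist i j = D i j := by
  have hw : ∀ {i j : V} (p : X.Walk i j), D i j ≤ p.length := by
    intro i j p
    induction p with
    | nil => simp [h0]
    | cons h p ih =>
      have := hlip _ _ _ h |>.trans (Nat.succ_le_succ ih)
      simpa using this
  have hex : ∀ n (i j : V), D i j = n → ∃ p : X.Walk i j, p.length = n := by
    intro n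
    induction n with
    | zero =>
      intro i j h
      obtain rfl := heq i j h
      exact ⟨.nil, rfl⟩
    | succ n ih =>
      intro i j h
      obtain ⟨k, hik, hk⟩ := hdesc i j (by omega)
      obtain ⟨p, hp⟩ := ih k j (by omega)
      exact ⟨.cons hik p, by simp [hp]⟩
  obtain ⟨p, hp⟩ := hex _ i j rfl
  obtain ⟨q, hq⟩ := p.reachable.exists_walk_length_eq_dist
  exact le_antisymm (hp ▸ SimpleGraph.dist_le p) (hq ▸ hw q)

end Graph

lemma C6_adj_iff (i j : Fin 6) : C6.Adj i j ↔ i ≠ j ∧ (j = i + 1 ∨ i = j + 1) := by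
  simp [C6]

lemma C6_dist (i j : Fin 6) : C6.dist i j = min (j - i).val (i - j).val := by
  refine dist_eq_of_descent (fun i j : Fin 6 => min (j - i).val (i - j).val) ?_ ?_ ?_ ?_ i j
  · decide
  · decide
  · simp only [C6_adj_iff]
    decide
  · simp only [C6_adj_iff]
    decide

lemma cubeGraph_adj_iff (x y : Fin 3 → Bool) : cubeGraph.Adj x y ↔
    (x 0 ^^ y 0).toNat + (x 1 ^^ y 1).toNat + (x 2 ^^ y 2).toNat = 1 := by
  simp only [cubeGraph, SimpleGraph.fromRel_adj, ExistsUnique]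
  revert x y
  decide

/-- In the cube, three vertices with pairwise common neighbours have a common neighbour. -/
lemma exists_common_neighbor_cubeGraph {a b r q c e : Fin 3 → Bool}
    (hab : a ≠ b) (har : a ≠ r) (hbr : b ≠ r)
    (hqa : cubeGraph.Adj q a) (hqb : cubeGraph.Adj q b) (hca : cubeGraph.Adj c a)
    (hcr : cubeGraph.Adj c r) (heb : cubeGraph.Adj e b) (her : cubeGraph.Adj e r) :
    ∃ m, cubeGraph.Adj m a ∧ cubeGraph.Adj m b ∧ cubeGraph.Adj m r := by
  have key : ∀ {x y z : Fin 3 → Bool}, x ≠ y → cubeGraph.Adj z x → cubeGraph.Adj z y →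
      (x 0 ^^ y 0).toNat + (x 1 ^^ y 1).toNat + (x 2 ^^ y 2).toNat = 2 := by
    simp only [cubeGraph_adj_iff]
    decide
  have h1 := key hab hqa hqb
  have h2 := key har hca hcr
  have h3 := key hbr heb her
  refine ⟨fun i => (a i && b i) || (a i && r i) || (b i && r i), ?_⟩
  simp only [cubeGraph_adj_iff]
  clear key hab har hbr hqa hqb hca hcr heb her
  generalize a 0 = a0, a 1 = a1, a 2 = a2, b 0 = b0, b 1 = b1, b 2 = b2, r 0 = r0, r 1 = r1,
    r 2 = r2 at *
  revert a0 a1 a2 b0 b1 b2 r0 r1 r2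
  decide

section QuasiMedian

variable {V : Type*} {X : SimpleGraph V}

/-- Two common neighbours of the ends of an edge are equal or adjacent. -/
lemma IsQuasiMedian.eq_or_adj (hX : IsQuasiMedian X) {a b c d : V} (hab : X.Adj a b)
    (hac : X.Adj a c) (hbc : X.Adj b c) (had : X.Adj a d) (hbd : X.Adj b d) :
    c = d ∨ X.Adj c d := by
  by_contra! h
  refine hX.noK112.false ⟨⟨![a, b, c, d], ?_⟩, ?_⟩
  · intro i j hij
    have := hab.ne
    have := hac.ne
    have := hbc.ne
    have := had.ne
    have := hbd.ne
    have := h.1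
    fin_cases i <;> fin_cases j <;> simp_all
  · intro i j
    change X.Adj (![a, b, c, d] i) (![a, b, c, d] j) ↔ K112.Adj i j
    have hdc : ¬ X.Adj d c := fun h' => h.2 h'.symm
    fin_cases i <;> fin_cases j <;> simp [K112, h.2, hdc, hab, hac, hbc, had, hbd, hab.symm,
      hac.symm, hbc.symm, had.symm, hbd.symm]

lemma IsQuasiMedian.exists_isQMTriple (hX : IsQuasiMedian X) (x₁ x₂ x₃ : V) :
    ∃ y₁ y₂ y₃ k, IsQMTriple X x₁ x₂ x₃ y₁ y₂ y₃ k := by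
  obtain ⟨y, ⟨k, hk, -⟩, -⟩ := hX.uniqueQuasiMedian x₁ x₂ x₃
  exact ⟨_, _, _, k, hk⟩

/-- The triangle condition. -/
lemma IsQuasiMedian.triangle (hX : IsQuasiMedian X) {p u v : V} (huv : X.Adj u v) {n : ℕ}
    (hu : X.dist u p = n + 1) (hv : X.dist v p = n + 1) :
    ∃ c, X.Adj u c ∧ X.Adj v c ∧ X.dist c p = n := by
  obtain ⟨y₁, y₂, y₃, k, h1, h2, h3, h4, h5, h6⟩ := hX.exists_isQMTriple p u v
  unfold OnGeod at *
  have hd := SimpleGraph.dist_eq_one_iff_adj.2 huv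
  have c1 := X.dist_comm (u := p) (v := u)
  have c2 := X.dist_comm (u := p) (v := v)
  have c3 := X.dist_comm (u := p) (v := y₁)
  have c4 := X.dist_comm (u := u) (v := y₂)
  have c5 := X.dist_comm (u := v) (v := y₃)
  have hk : k = 1 := by
    by_contra hk
    have hk : k = 0 := by omega
    omega
  have e1 : u = y₂ := hX.connected.dist_eq_zero_iff.1 (by omega)
  have e2 : y₃ = v := hX.connected.dist_eq_zero_iff.1 (by omega)
  subst e1 e2 hk
  exact ⟨y₁, (SimpleGraph.dist_eq_one_iff_adj.1 h4).symm,
    (SimpleGraph.dist_eq_one_iff_adj.1 h5).symm, by omega⟩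

/-- Vertices with a common neighbour are at distance at most two. -/
lemma dist_le_two (hX : X.Connected) {u v w : V} (h1 : X.Adj u v) (h2 : X.Adj v w) :
    X.dist u w ≤ 2 := by
  have := dist_le_succ_of_adj hX h1 (v := w)
  rwa [SimpleGraph.dist_eq_one_iff_adj.2 h2] at this

/-- If `a` and `e` lie on geodesics of length three between `q` and `r`, at distance one from `q`
and from `r` respectively, then they cannot be at distance two. -/
lemma IsQuasiMedian.three_le_dist (hX : IsQuasiMedian X) {q r a e : V} (hqr : X.dist q r = 3)
    (hqa : X.Adj q a) (her : X.Adj e r) (har : X.dist a r = 2) (hqe : X.dist q e = 2)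
    (hae : ¬ X.Adj a e) : 3 ≤ X.dist a e := by
  have hc := hX.connected
  have hne : a ≠ e := by
    rintro rfl
    rw [SimpleGraph.dist_eq_one_iff_adj.2 her] at har
    omega
  have h1 := hc.one_lt_dist_of_ne_of_not_adj hne hae
  by_contra! h3
  obtain ⟨t, hqt, hat, hte⟩ := hX.triangle (p := e) hqa (n := 1) hqe (by omega)
  rw [SimpleGraph.dist_eq_one_iff_adj] at hte
  have htr : X.dist t r = 2 := by
    have h4 := dist_le_two hc hte her
    have h5 := dist_le_succ_of_adj hc hqt (v := r)
    omega
  obtain ⟨u, hau, htu, hur⟩ := hX.triangle (p := r) hat (n := 1) har htr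
  have h6 := hX.eq_or_adj hat hqa.symm hqt.symm hau htu
  rcases h6 with rfl | h6
  · omega
  · have := dist_le_succ_of_adj hc h6 (v := r)
    omega

/-- The six-cycle case of the quadrangle condition. -/
lemma IsQuasiMedian.exists_common_neighbor (hX : IsQuasiMedian X) {q r a b : V}
    (hqr : X.dist q r = 3) (hqa : X.Adj q a) (hqb : X.Adj q b) (hab : X.dist a b = 2)
    (har : X.dist a r = 2) (hbr : X.dist b r = 2) :
    ∃ m, X.Adj a m ∧ X.Adj b m ∧ X.Adj m r := by
  have hc := hX.connected
  obtain ⟨c, hac, hcr⟩ := exists_adj_dist_eq hc har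
  obtain ⟨e, hbe, her⟩ := exists_adj_dist_eq hc hbr
  rw [SimpleGraph.dist_eq_one_iff_adj] at hcr her
  by_contra! hm
  have hae : ¬ X.Adj a e := fun h => hm e h hbe her
  have hbc : ¬ X.Adj b c := fun h => hm c hac h hcr
  have hqe : X.dist q e = 2 := by
    have h1 := dist_le_two hc hqb hbe
    have h2 := hc.dist_triangle (u := q) (v := e) (w := r)
    rw [SimpleGraph.dist_eq_one_iff_adj.2 her] at h2
    omega
  have hqc : X.dist q c = 2 := by
    have h1 := dist_le_two hc hqa hac
    have h2 := hc.dist_triangle (u := q) (v := c) (w := r)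
    rw [SimpleGraph.dist_eq_one_iff_adj.2 hcr] at h2
    omega
  have dae : X.dist a e = 3 := by
    have h1 := hX.three_le_dist hqr hqa her har hqe hae
    have h2 := dist_le_succ_of_adj hc hqa.symm (v := e)
    omega
  have dbc : X.dist b c = 3 := by
    have h1 := hX.three_le_dist hqr hqb hcr hbr hqc hbc
    have h2 := dist_le_succ_of_adj hc hqb.symm (v := c)
    omega
  have hce : c ≠ e := by
    rintro rfl
    exact hbc hbe
  have hceadj : ¬ X.Adj c e := by
    intro h
    have h1 := dist_le_two hc hac h
    omega
  have dce : X.dist c e = 2 := by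
    have h1 := hc.one_lt_dist_of_ne_of_not_adj hce hceadj
    have h2 := dist_le_two hc hcr her.symm
    omega
  have dqa := SimpleGraph.dist_eq_one_iff_adj.2 hqa
  have dqb := SimpleGraph.dist_eq_one_iff_adj.2 hqb
  have dac := SimpleGraph.dist_eq_one_iff_adj.2 hac
  have dcr := SimpleGraph.dist_eq_one_iff_adj.2 hcr
  have dbe := SimpleGraph.dist_eq_one_iff_adj.2 hbe
  have der := SimpleGraph.dist_eq_one_iff_adj.2 her
  obtain ⟨φ⟩ := hX.hullOfC6IsCube ![q, a, c, r, e, b]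
    (by
      intro i j
      rw [C6_adj_iff]
      fin_cases i <;> fin_cases j <;>
        simp [hqa, hqb, hac, hcr, her, hbe, hqa.symm, hqb.symm, hac.symm, hcr.symm, her.symm,
          hbe.symm])
    (by
      intro i j
      rw [C6_dist]
      fin_cases i <;> fin_cases j <;>
        first
        | simp; done
        | simpa
        | (rw [X.dist_comm]; simpa))
  have hmem : ∀ i, ![q, a, c, r, e, b] i ∈ convexHullSet X (Set.range ![q, a, c, r, e, b]) :=
    fun i => Set.mem_sInter.2 fun T hT => hT.1 ⟨i, rfl⟩
  have hadj : ∀ i j, X.Adj (![q, a, c, r, e, b] i) (![q, a, c, r, e, b] j) →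
      cubeGraph.Adj (φ ⟨_, hmem i⟩) (φ ⟨_, hmem j⟩) := fun i j h => φ.map_adj_iff.2 h
  have hne : ∀ i j, ![q, a, c, r, e, b] i ≠ ![q, a, c, r, e, b] j →
      φ ⟨_, hmem i⟩ ≠ φ ⟨_, hmem j⟩ :=
    fun i j h h' => h (congrArg Subtype.val (φ.injective h'))
  obtain ⟨m, hma, hmb, hmr⟩ := exists_common_neighbor_cubeGraph
    (hne 1 5 (by rintro (rfl : a = b); simp at hab))
    (hne 1 3 (by rintro (rfl : a = r); simp at har))
    (hne 5 3 (by rintro (rfl : b = r); simp at hbr))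
    (hadj 0 1 hqa) (hadj 0 5 hqb) (hadj 2 1 hac.symm) (hadj 2 3 hcr) (hadj 4 5 hbe.symm)
    (hadj 4 3 her)
  obtain ⟨m, rfl⟩ := φ.surjective m
  rw [φ.map_adj_iff] at hma hmb hmr
  exact hm m hma.symm hmb.symm hmr

/-- The quadrangle condition. -/
lemma IsQuasiMedian.quadrangle (hX : IsQuasiMedian X) {p q a b : V} (hqa : X.Adj q a)
    (hqb : X.Adj q b) (hne : a ≠ b) (hab : ¬ X.Adj a b) {n : ℕ} (hq : X.dist q p = n + 2)
    (ha : X.dist a p = n + 1) (hb : X.dist b p = n + 1) :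
    ∃ c, X.Adj a c ∧ X.Adj b c ∧ X.dist c p = n := by
  have hc := hX.connected
  have dab : X.dist a b = 2 := by
    have h1 := hc.one_lt_dist_of_ne_of_not_adj hne hab
    have h2 := dist_le_two hc hqa.symm hqb
    omega
  obtain ⟨y₁, y₂, y₃, k, h1, h2, h3, h4, h5, h6⟩ := hX.exists_isQMTriple p a b
  unfold OnGeod at *
  have c1 := X.dist_comm (u := p) (v := a)
  have c2 := X.dist_comm (u := p) (v := b)
  have c3 := X.dist_comm (u := p) (v := y₁)
  have c4 := X.dist_comm (u := a) (v := y₂)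
  have c5 := X.dist_comm (u := b) (v := y₃)
  have hk : k = 0 ∨ k = 2 := by omega
  rcases hk with rfl | rfl
  · obtain rfl := hc.dist_eq_zero_iff.1 h4
    obtain rfl := hc.dist_eq_zero_iff.1 h5
    exact ⟨y₁, SimpleGraph.dist_eq_one_iff_adj.1 (by omega),
      SimpleGraph.dist_eq_one_iff_adj.1 (by omega), by omega⟩
  · have e1 : a = y₂ := hc.dist_eq_zero_iff.1 (by omega)
    have e2 : y₃ = b := hc.dist_eq_zero_iff.1 (by omega)
    subst e1 e2
    have h4' := X.dist_comm (u := y₁) (v := a)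
    have h5' := X.dist_comm (u := y₁) (v := y₃)
    have hqr : X.dist q y₁ = 3 := by
      have h7 := dist_le_succ_of_adj hc hqa (v := y₁)
      have h8 := hc.dist_triangle (u := q) (v := y₁) (w := p)
      omega
    obtain ⟨m, ham, hbm, hmr⟩ := hX.exists_common_neighbor hqr hqa hqb dab (by omega) (by omega)
    have h9 := dist_le_succ_of_adj hc hmr (v := p)
    have h10 := dist_le_succ_of_adj hc ham (v := p)
    exact ⟨m, ham, hbm, by omega⟩

open Relation (EqvGen)

/-- Geodesics with the same endpoints cross the same hyperplanes. -/
lemma IsQuasiMedian.exists_parallel_of_geodesics (hX : IsQuasiMedian X) {n : ℕ} {q p : V}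
    (γ γ' : X.Walk q p) (hγ : γ.length = n) (hγ' : γ'.length = n) (hn : X.dist q p = n) :
    ∀ e ∈ γ.edges, ∃ f ∈ γ'.edges, EqvGen (SideRel X) e f := by
  have hc := hX.connected
  induction n generalizing q with
  | zero =>
    rw [SimpleGraph.Walk.length_eq_zero_iff] at hγ
    intro e he
    cases γ <;> simp_all
  | succ n ih =>
    cases γ with
    | nil => simp at hγ
    | @cons _ a _ hqa γ =>
    cases γ' with
    | nil => simp at hγ'
    | @cons _ b _ hqb γ' =>
    rw [SimpleGraph.Walk.length_cons, Nat.add_right_cancel_iff] at hγ hγ'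
    have ha : X.dist a p = n := by
      have h1 := SimpleGraph.dist_le γ
      have h2 := dist_le_succ_of_adj hc hqa (v := p)
      omega
    have hb : X.dist b p = n := by
      have h1 := SimpleGraph.dist_le γ'
      have h2 := dist_le_succ_of_adj hc hqb (v := p)
      omega
    by_cases hab : a = b
    · subst hab
      intro e he
      rw [SimpleGraph.Walk.edges_cons, List.mem_cons] at he
      rcases he with rfl | he
      · exact ⟨_, by simp, .refl _⟩
      · obtain ⟨f, hf, hef⟩ := ih γ γ' hγ hγ' ha e he
        exact ⟨f, by simp [hf], hef⟩
    obtain ⟨n, rfl⟩ : ∃ m, n = m + 1 := by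
      refine Nat.exists_eq_succ_of_ne_zero ?_
      rintro rfl
      rw [hc.dist_eq_zero_iff] at ha hb
      exact hab (ha.trans hb.symm)
    have hnadj : ¬ X.Adj a b := by
      intro h
      obtain ⟨c, hac, hbc, hcp⟩ := hX.triangle h ha hb
      rcases hX.eq_or_adj h hqa.symm hqb.symm hac hbc with rfl | h'
      · omega
      · have := dist_le_succ_of_adj hc h' (v := p)
        omega
    obtain ⟨c, hac, hbc, hcp⟩ := hX.quadrangle hqa hqb hab hnadj hn ha hb
    have hqc : q ≠ c := by
      rintro rfl
      omega
    obtain ⟨γc, hγc⟩ := hc.exists_walk_length_eq_dist c p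
    have ihb := ih (.cons hbc γc) γ' (by simp; omega) hγ' hb
    intro e he
    rw [SimpleGraph.Walk.edges_cons, List.mem_cons] at he
    rcases he with rfl | he
    · obtain ⟨f, hf, hef⟩ := ihb s(b, c) (by simp)
      exact ⟨f, by simp [hf],
        .trans _ _ _ (.rel _ _ (.inr ⟨q, a, b, c, hqa, hbc, hqb, hac, hqc, hab, rfl, rfl⟩)) hef⟩
    · obtain ⟨f, hf, hef⟩ := ih γ (.cons hac γc) hγ (by simp; omega) ha e he
      rw [SimpleGraph.Walk.edges_cons, List.mem_cons] at hf
      rcases hf with rfl | hf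
      · exact ⟨s(q, b), by simp, .trans _ _ _ hef (.rel _ _ (.inr
          ⟨a, c, q, b, hac, hqb, hqa.symm, hbc.symm, hab, hqc.symm, rfl, rfl⟩))⟩
      · obtain ⟨f', hf', hff'⟩ := ihb f (by simp [hf])
        exact ⟨f', by simp [hf'], .trans _ _ _ hef hff'⟩

/-- A walk crosses every hyperplane crossed by a geodesic with the same endpoints. -/
lemma IsQuasiMedian.exists_parallel_of_geodesic (hX : IsQuasiMedian X) {q p : V}
    (γ w : X.Walk q p) (hγ : IsGeodesicWalk X γ) :
    ∀ e ∈ γ.edges, ∃ f ∈ w.edges, EqvGen (SideRel X) e f := by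
  have hc := hX.connected
  induction w with
  | nil =>
    have : γ.length = 0 := by simpa [IsGeodesicWalk] using hγ
    intro e he
    cases γ <;> simp_all
  | @cons q v p hqv w ih =>
    obtain ⟨γv, hγv⟩ := hc.exists_walk_length_eq_dist v p
    have h1 := dist_le_succ_of_adj hc hqv (v := p)
    have h2 := dist_le_succ_of_adj hc hqv.symm (v := p)
    obtain h | h | h : X.dist q p = X.dist v p + 1 ∨ X.dist v p = X.dist q p + 1 ∨
        X.dist q p = X.dist v p := by omega
    · intro e he
      obtain ⟨f, hf, hef⟩ := hX.exists_parallel_of_geodesics γ (.cons hqv γv) hγ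
        (by simp; omega) rfl e he
      rw [SimpleGraph.Walk.edges_cons, List.mem_cons] at hf
      rcases hf with rfl | hf
      · exact ⟨_, by simp, hef⟩
      · obtain ⟨f', hf', hff'⟩ := ih γv hγv f hf
        exact ⟨f', by simp [hf'], .trans _ _ _ hef hff'⟩
    · intro e he
      have hg : IsGeodesicWalk X (.cons hqv.symm γ) := by
        unfold IsGeodesicWalk at *
        simp
        omega
      obtain ⟨f, hf, hef⟩ := ih _ hg e (by simp [he])
      exact ⟨f, by simp [hf], hef⟩
    · obtain ⟨n, hn⟩ : ∃ n, X.dist v p = n + 1 := by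
        refine Nat.exists_eq_succ_of_ne_zero fun h0 => ?_
        rw [h0] at h
        rw [hc.dist_eq_zero_iff] at h h0
        exact hqv.ne (h.trans h0.symm)
      obtain ⟨c, hqc, hvc, hcp⟩ := hX.triangle hqv (h.trans hn) hn
      obtain ⟨γc, hγc⟩ := hc.exists_walk_length_eq_dist c p
      have hg : IsGeodesicWalk X (.cons hvc γc) := by
        unfold IsGeodesicWalk
        simp
        omega
      intro e he
      obtain ⟨f, hf, hef⟩ := hX.exists_parallel_of_geodesics γ (.cons hqc γc) hγ
        (by simp; omega) rfl e he
      rw [SimpleGraph.Walk.edges_cons, List.mem_cons] at hf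
      rcases hf with rfl | hf
      · exact ⟨_, by simp,
          .trans _ _ _ hef (.rel _ _ (.inl ⟨q, c, v, hqc, hqv, hvc.symm, rfl, rfl⟩))⟩
      · obtain ⟨f', hf', hff'⟩ := ih _ hg f (by simp [hf])
        exact ⟨f', by simp [hf'], .trans _ _ _ hef hff'⟩

end QuasiMedian

section Contact

variable {V : Type*} {X : SimpleGraph V}

open Relation (EqvGen)

lemma SideRel.mem_edgeSet {e f : Sym2 V} (h : SideRel X e f) :
    e ∈ X.edgeSet ∧ f ∈ X.edgeSet := by
  rcases h with ⟨a, b, c, h1, h2, -, rfl, rfl⟩ | ⟨a, b, c, d, h1, h2, -, -, -, -, rfl, rfl⟩ <;>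
    exact ⟨h1, h2⟩

lemma mem_edgeSet_iff_of_eqvGen {e f : Sym2 V} (h : EqvGen (SideRel X) e f) :
    e ∈ X.edgeSet ↔ f ∈ X.edgeSet := by
  induction h with
  | rel _ _ h => exact iff_of_true h.mem_edgeSet.1 h.mem_edgeSet.2
  | refl => rfl
  | symm _ _ _ ih => exact ih.symm
  | trans _ _ _ _ _ ih ih' => exact ih.trans ih'

/-- The hyperplane dual to an edge. -/
def hyperplaneOf {e : Sym2 V} (he : e ∈ X.edgeSet) : Hyperplane X :=
  ⟨hypClass X e, e, he, rfl⟩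

lemma mem_hyperplaneOf {e : Sym2 V} (he : e ∈ X.edgeSet) : e ∈ (hyperplaneOf he).1 :=
  EqvGen.refl e

lemma Hyperplane.mem_of_eqvGen {H : Hyperplane X} {e f : Sym2 V} (he : e ∈ H.1)
    (h : EqvGen (SideRel X) e f) : f ∈ H.1 := by
  obtain ⟨g, -, hg⟩ := H.2
  rw [hg] at he ⊢
  exact EqvGen.trans _ _ _ he h

lemma Hyperplane.eqvGen {H : Hyperplane X} {e f : Sym2 V} (he : e ∈ H.1) (hf : f ∈ H.1) :
    EqvGen (SideRel X) e f := by
  obtain ⟨g, -, hg⟩ := H.2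
  rw [hg] at he hf
  exact EqvGen.trans _ _ _ (.symm _ _ he) hf

lemma Hyperplane.mem_edgeSet {H : Hyperplane X} {e : Sym2 V} (he : e ∈ H.1) :
    e ∈ X.edgeSet := by
  obtain ⟨_, g, hg, rfl⟩ := H
  exact (mem_edgeSet_iff_of_eqvGen he).1 hg

lemma Hyperplane.eq_of_mem {H K : Hyperplane X} {e : Sym2 V} (hH : e ∈ H.1) (hK : e ∈ K.1) :
    H = K :=
  Subtype.ext <| Set.ext fun _ =>
    ⟨fun h => K.mem_of_eqvGen hK (H.eqvGen hH h), fun h => H.mem_of_eqvGen hH (K.eqvGen hK h)⟩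

lemma Hyperplane.eq_of_mem_of_eqvGen {H K : Hyperplane X} {e f : Sym2 V} (hH : e ∈ H.1)
    (hK : f ∈ K.1) (h : EqvGen (SideRel X) e f) : H = K :=
  H.eq_of_mem (H.mem_of_eqvGen hH h) hK

/-- Hyperplanes whose carriers share a vertex are equal or adjacent in the contact graph. -/
lemma eq_or_adj_of_mem_hypCarrier {H K : Hyperplane X} {p : V} (hH : p ∈ hypCarrier X H)
    (hK : p ∈ hypCarrier X K) : H = K ∨ (contactGraph X).Adj H K := by
  obtain ⟨e, he, a, rfl⟩ := hH
  obtain ⟨f, hf, b, rfl⟩ := hK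
  have hpa : X.Adj p a := H.mem_edgeSet he
  have hpb : X.Adj p b := K.mem_edgeSet hf
  refine or_iff_not_imp_left.2 fun hne => ?_
  have hab : a ≠ b := by
    rintro rfl
    exact hne (H.eq_of_mem he hf)
  have hnadj : ¬ X.Adj a b := fun h =>
    hne (H.eq_of_mem_of_eqvGen he hf (.rel _ _ (.inl ⟨p, a, b, hpa, hpb, h, rfl, rfl⟩)))
  rw [contactGraph, SimpleGraph.fromRel_adj]
  refine ⟨hne, .inl ?_⟩
  by_cases hq : ∃ q : V, q ≠ p ∧ X.Adj a q ∧ X.Adj b q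
  · exact .inl ⟨p, _, he, _, hf, a, b, rfl, rfl, hpa, hpb, hab, hnadj, hq⟩
  · exact .inr ⟨p, _, he, _, hf, a, b, rfl, rfl, hpa, hpb, hab, hnadj, hq⟩

lemma dist_le_one_of_mem_hypCarrier {H K : Hyperplane X} {p : V} (hH : p ∈ hypCarrier X H)
    (hK : p ∈ hypCarrier X K) : (contactGraph X).dist H K ≤ 1 := by
  rcases eq_or_adj_of_mem_hypCarrier hH hK with rfl | h
  · simp
  · exact (SimpleGraph.dist_eq_one_iff_adj.2 h).le

/-- The carriers of adjacent hyperplanes share a vertex. -/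
lemma exists_mem_hypCarrier_of_adj {H K : Hyperplane X} (h : (contactGraph X).Adj H K) :
    ∃ p, p ∈ hypCarrier X H ∧ p ∈ hypCarrier X K := by
  rw [contactGraph, SimpleGraph.fromRel_adj] at h
  obtain ⟨-, (⟨p, h⟩ | ⟨p, h⟩) | (⟨p, h⟩ | ⟨p, h⟩)⟩ := h <;>
    obtain ⟨e, he, f, hf, a, b, rfl, rfl, -⟩ := h
  · exact ⟨p, ⟨_, he, by simp⟩, ⟨_, hf, by simp⟩⟩
  · exact ⟨p, ⟨_, he, by simp⟩, ⟨_, hf, by simp⟩⟩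
  · exact ⟨p, ⟨_, hf, by simp⟩, ⟨_, he, by simp⟩⟩
  · exact ⟨p, ⟨_, hf, by simp⟩, ⟨_, he, by simp⟩⟩

lemma Hyperplane.exists_mem_hypCarrier (H : Hyperplane X) : ∃ p, p ∈ hypCarrier X H := by
  obtain ⟨_, e, he, rfl⟩ := H
  induction e with
  | h a b => exact ⟨a, s(a, b), EqvGen.refl _, by simp⟩

/-- A walk between the carriers of two hyperplanes induces a walk in the contact graph. -/
lemma exists_contact_walk {p q : V} (γ : X.Walk p q) {H K : Hyperplane X}
    (hH : p ∈ hypCarrier X H) (hK : q ∈ hypCarrier X K) :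
    ∃ W : (contactGraph X).Walk H K, ∀ J ∈ W.support, J = H ∨ J = K ∨ ∃ e ∈ γ.edges, e ∈ J.1 := by
  induction γ generalizing H with
  | nil =>
    rcases eq_or_adj_of_mem_hypCarrier hH hK with rfl | h
    · exact ⟨.nil, by simp⟩
    · exact ⟨.cons h .nil, by simp⟩
  | @cons p a q hpa γ ih =>
    have hmem := mem_hyperplaneOf (X := X) (e := s(p, a)) hpa
    obtain ⟨W, hW⟩ := ih (H := hyperplaneOf (e := s(p, a)) hpa) ⟨_, hmem, by simp⟩ hK
    have hW' : ∀ J ∈ W.support,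
        J = K ∨ ∃ e ∈ (SimpleGraph.Walk.cons hpa γ).edges, e ∈ J.1 := by
      intro J hJ
      rcases hW J hJ with rfl | h | ⟨e, he, heJ⟩
      · exact .inr ⟨_, by simp, hmem⟩
      · exact .inl h
      · exact .inr ⟨e, by simp [he], heJ⟩
    rcases eq_or_adj_of_mem_hypCarrier hH (K := hyperplaneOf (e := s(p, a)) hpa)
      ⟨_, hmem, by simp⟩ with h | h
    · subst h
      exact ⟨W, fun J hJ => .inr (hW' J hJ)⟩
    · refine ⟨.cons h W, fun J hJ => ?_⟩
      rw [SimpleGraph.Walk.support_cons, List.mem_cons] at hJ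
      exact hJ.imp_right (hW' J)

lemma contactGraph_preconnected (hX : X.Connected) : (contactGraph X).Preconnected := by
  intro H K
  obtain ⟨p, hp⟩ := H.exists_mem_hypCarrier
  obtain ⟨q, hq⟩ := K.exists_mem_hypCarrier
  obtain ⟨γ⟩ := hX.preconnected p q
  exact ⟨(exists_contact_walk γ hp hq).choose⟩

/-- Every hyperplane crossed by `w` is at distance at most one in the contact graph from some
element of `S`. -/
def CrossesNear {p q : V} (w : X.Walk p q) (S : Set (Hyperplane X)) : Prop :=
  ∀ H : Hyperplane X, ∀ e ∈ w.edges, e ∈ H.1 → ∃ K ∈ S, (contactGraph X).dist H K ≤ 1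

lemma CrossesNear.append {p q r : V} {w : X.Walk p q} {w' : X.Walk q r}
    {S : Set (Hyperplane X)} (h : CrossesNear w S) (h' : CrossesNear w' S) :
    CrossesNear (w.append w') S := by
  intro H e he heH
  rw [SimpleGraph.Walk.edges_append, List.mem_append] at he
  exact he.elim (fun he => h H e he heH) (fun he => h' H e he heH)

lemma CrossesNear.reverse {p q : V} {w : X.Walk p q} {S : Set (Hyperplane X)}
    (h : CrossesNear w S) : CrossesNear w.reverse S := by
  intro H e he heH
  exact h H e (by simpa using he) heH

lemma CrossesNear.mono {p q : V} {w : X.Walk p q} {S T : Set (Hyperplane X)} (hST : S ⊆ T)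
    (h : CrossesNear w S) : CrossesNear w T := by
  intro H e he heH
  obtain ⟨K, hK, hd⟩ := h H e he heH
  exact ⟨K, hST hK, hd⟩

lemma crossesNear_nil (p : V) (S : Set (Hyperplane X)) :
    CrossesNear (.nil : X.Walk p p) S := by
  intro H e he
  simp at he

/-- An edge with an end in the carrier of `K` crosses near `K`. -/
lemma crossesNear_edge {K : Hyperplane X} {p q : V} (h : X.Adj p q)
    (hp : p ∈ hypCarrier X K) : CrossesNear (.cons h .nil) {K} := by
  intro H e he heH
  simp only [SimpleGraph.Walk.edges_cons, SimpleGraph.Walk.edges_nil, List.mem_singleton] at he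
  subst he
  exact ⟨K, rfl, dist_le_one_of_mem_hypCarrier ⟨_, heH, by simp⟩ hp⟩

/-- Two vertices on one edge dual to `K` are joined by a walk crossing near `K`. -/
lemma exists_crossesNear_of_mem_edge {K : Hyperplane X} {e : Sym2 V} (he : e ∈ K.1) {p q : V}
    (hp : p ∈ e) (hq : q ∈ e) : ∃ w : X.Walk p q, CrossesNear w {K} := by
  by_cases hpq : p = q
  · subst hpq
    exact ⟨.nil, crossesNear_nil _ _⟩
  · obtain rfl := (Sym2.mem_and_mem_iff hpq).1 ⟨hp, hq⟩
    exact ⟨.cons (K.mem_edgeSet he) .nil, crossesNear_edge _ ⟨_, he, hp⟩⟩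

/-- Two vertices of the carrier of `K` are joined by a walk crossing near `K`. -/
lemma exists_crossesNear_singleton {K : Hyperplane X} {p q : V} (hp : p ∈ hypCarrier X K)
    (hq : q ∈ hypCarrier X K) : ∃ w : X.Walk p q, CrossesNear w {K} := by
  obtain ⟨e, he, hpe⟩ := hp
  obtain ⟨f, hf, hqf⟩ := hq
  have hef := K.eqvGen he hf
  induction hef generalizing p q with
  | rel e f h =>
    suffices ∃ a ∈ e, ∃ b ∈ f, ∃ w : X.Walk a b, CrossesNear w {K} by
      obtain ⟨a, ha, b, hb, w, hw⟩ := this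
      obtain ⟨w₁, hw₁⟩ := exists_crossesNear_of_mem_edge he hpe ha
      obtain ⟨w₂, hw₂⟩ := exists_crossesNear_of_mem_edge hf hb hqf
      exact ⟨(w₁.append w).append w₂, (hw₁.append hw).append hw₂⟩
    rcases h with ⟨a, b, c, -, -, -, rfl, rfl⟩ | ⟨a, b, c, d, -, -, hac, -, -, -, rfl, rfl⟩
    · exact ⟨a, by simp, a, by simp, .nil, crossesNear_nil _ _⟩
    · exact ⟨a, by simp, c, by simp, .cons hac .nil, crossesNear_edge _ ⟨_, he, by simp⟩⟩
  | refl e => exact exists_crossesNear_of_mem_edge he hpe hqf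
  | symm e f _ ih =>
    obtain ⟨w, hw⟩ := ih hf hqf he hpe
    exact ⟨w.reverse, hw.reverse⟩
  | trans e g f h _ ih ih' =>
    have hg := K.mem_of_eqvGen he h
    obtain ⟨w, hw⟩ := ih he hpe hg (Sym2.out_fst_mem g)
    obtain ⟨w', hw'⟩ := ih' hg (Sym2.out_fst_mem g) hf hqf
    exact ⟨w.append w', hw.append hw'⟩

/-- A walk in the contact graph is shadowed by a walk in the graph. -/
lemma exists_crossesNear_support {H K : Hyperplane X} (W : (contactGraph X).Walk H K) {p q : V}
    (hp : p ∈ hypCarrier X H) (hq : q ∈ hypCarrier X K) :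
    ∃ w : X.Walk p q, CrossesNear w {J | J ∈ W.support} := by
  induction W generalizing p with
  | nil =>
    obtain ⟨w, hw⟩ := exists_crossesNear_singleton hp hq
    exact ⟨w, hw.mono (by simp)⟩
  | cons h W ih =>
    obtain ⟨r, hr, hr'⟩ := exists_mem_hypCarrier_of_adj h
    obtain ⟨w, hw⟩ := exists_crossesNear_singleton hp hr
    obtain ⟨w', hw'⟩ := ih hr' hq
    exact ⟨w.append w', (hw.mono (by simp)).append (hw'.mono fun J hJ => by simp_all)⟩

lemma IsQuasiMedian.crossesNear_of_geodesic (hX : IsQuasiMedian X) {p q : V} {γ w : X.Walk p q}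
    (hγ : IsGeodesicWalk X γ) {S : Set (Hyperplane X)} (hw : CrossesNear w S) :
    CrossesNear γ S := by
  intro H e he heH
  obtain ⟨f, hf, hef⟩ := hX.exists_parallel_of_geodesic γ w hγ e he
  exact hw H f hf (H.mem_of_eqvGen heH hef)

/-- The bottleneck property of the contact graph: a walk stays close to every vertex of a
geodesic with the same endpoints. -/
lemma IsQuasiMedian.contactGraph_bottleneck (hX : IsQuasiMedian X) {x z : Hyperplane X}
    {π W : (contactGraph X).Walk x z} (hπ : IsGeodesicWalk (contactGraph X) π)
    {H : Hyperplane X} (hH : H ∈ π.support) :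
    ∃ K ∈ W.support, (contactGraph X).dist H K ≤ 3 := by
  have hC : (contactGraph X).Connected :=
    { preconnected := contactGraph_preconnected hX.connected, nonempty := ⟨x⟩ }
  obtain ⟨p, hp⟩ := x.exists_mem_hypCarrier
  obtain ⟨q, hq⟩ := z.exists_mem_hypCarrier
  obtain ⟨γ, hγ⟩ := hX.connected.exists_walk_length_eq_dist p q
  obtain ⟨w₁, hw₁⟩ := exists_crossesNear_support π hp hq
  obtain ⟨w₂, hw₂⟩ := exists_crossesNear_support W hp hq
  obtain ⟨Γ, hΓ⟩ := exists_contact_walk γ hp hq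
  have hHz := dist_add_dist_of_mem_support hC hπ hH
  obtain ⟨J, hJ, hJd⟩ := exists_mem_support_dist_eq hC Γ (i := (contactGraph X).dist x H)
    (by omega)
  suffices ∃ K ∈ π.support, (contactGraph X).dist J K ≤ 1 ∧
      ∃ L ∈ W.support, (contactGraph X).dist J L ≤ 1 by
    obtain ⟨K, hK, hJK, L, hL, hJL⟩ := this
    have h1 := dist_le_of_mem_support hC hπ hH hK
    have h2 := hC.dist_triangle (u := x) (v := J) (w := K)
    have h3 := hC.dist_triangle (u := x) (v := K) (w := J)
    have h4 := hC.dist_triangle (u := H) (v := K) (w := J)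
    have h5 := hC.dist_triangle (u := H) (v := J) (w := L)
    rw [(contactGraph X).dist_comm (u := K)] at h3 h4
    exact ⟨L, hL, by omega⟩
  rcases hΓ J hJ with rfl | rfl | ⟨e, he, heJ⟩
  · exact ⟨J, by simp, by simp, J, by simp, by simp⟩
  · exact ⟨J, by simp, by simp, J, by simp, by simp⟩
  · obtain ⟨K, hK, hKd⟩ := hX.crossesNear_of_geodesic hγ hw₁ J e he heJ
    exact ⟨K, hK, hKd, hX.crossesNear_of_geodesic hγ hw₂ J e he heJ⟩

end Contact

/-- There is a universal constant `δ > 0` such that for every quasi-median graph `X`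
the contact graph `𝒞X` is `δ`-hyperbolic: every geodesic triangle in `𝒞X` is `δ`-slim. -/
theorem contactGraph_hyperbolic :
    ∃ δ : ℝ, 0 < δ ∧ ∀ {V : Type u} (X : SimpleGraph V), IsQuasiMedian X →
      ∀ (x y z : Hyperplane X) (pxy : (contactGraph X).Walk x y)
        (pyz : (contactGraph X).Walk y z) (pxz : (contactGraph X).Walk x z),
        IsGeodesicWalk (contactGraph X) pxy → IsGeodesicWalk (contactGraph X) pyz →
        IsGeodesicWalk (contactGraph X) pxz →
        ∀ w ∈ pxz.support, ∃ w' : Hyperplane X,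
          (w' ∈ pxy.support ∨ w' ∈ pyz.support) ∧
            ((contactGraph X).dist w w' : ℝ) ≤ δ := by
  refine ⟨3, by norm_num, ?_⟩
  intro V X hX x y z pxy pyz pxz _ _ hxz w hw
  obtain ⟨w', hw', hd⟩ := hX.contactGraph_bottleneck (W := pxy.append pyz) hxz hw
  exact ⟨w', (SimpleGraph.Walk.mem_support_append_iff _ _).1 hw', by exact_mod_cast hd⟩

end QM
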